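/- arXiv:math/0703030 — 2 statements merged into one kernel-verified Lean document; each statement's English description precedes it below -/
import Mathlib

section
/- Fix 0<a<1 and γ>0, and for each positive integer n set q_n := exp(−2π/(γ n^a)). Then there exist a constant C>0 and a positive integer N such that for all n ≥ N, |(q_n; q_n)_∞ / (√(γ n^a) · exp((π/12)·(1/(γ n^a) − γ n^a))) − 1| ≤ C·exp(−2π γ n^a). -/
open Real

/-- The infinite q-shifted factorial `(a;q)_∞ = ∏_{k=0}^∞ (1 - a q^k)` (real version). -/
noncomputable def qPochInfR (a q : ℝ) : ℝ := ∏' k : ℕ, (1 - a * q ^ k)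

lemma ofReal_qPochInfR_self {q : ℝ} (hq : |q| < 1) :
    (qPochInfR q q : ℂ) = ∏' k : ℕ, (1 - (q : ℂ) ^ (k + 1)) := by
  have hm : Multipliable fun k : ℕ ↦ 1 - q ^ (k + 1) := by
    simp_rw [sub_eq_add_neg]
    apply multipliable_one_add_of_summable
    simpa using (summable_nat_add_iff 1).mpr (summable_geometric_of_lt_one (abs_nonneg _) hq)
  have h := hm.map_tprod Complex.ofRealHom Complex.continuous_ofReal
  simp only [Complex.ofRealHom_eq_coe, Complex.ofReal_sub, Complex.ofReal_one,
    Complex.ofReal_pow] at h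
  simpa only [qPochInfR, ← pow_succ'] using h

lemma qPochInfR_self_sub_one_isBigO :
    (fun q : ℝ ↦ qPochInfR q q - 1) =O[nhds 0] fun q ↦ q := by
  have hd : DifferentiableAt ℂ (fun q : ℂ ↦ ∏' k : ℕ, (1 - q ^ (k + 1))) 0 :=
    ModularForm.differentiableOn_tprod_one_sub_pow.differentiableAt
      (Metric.ball_mem_nhds 0 one_pos)
  have hc : Filter.Tendsto Complex.ofReal (nhds 0) (nhds 0) := by
    simpa using Complex.continuous_ofReal.tendsto 0
  have hO := hd.isBigO_sub.comp_tendsto hc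
  refine (hO.norm_norm.congr' ?_ ?_).of_norm_norm
  · filter_upwards [Metric.ball_mem_nhds (0 : ℝ) one_pos] with q hq
    have hq' : |q| < 1 := by simpa using hq
    rw [← Complex.norm_real, Complex.ofReal_sub, ofReal_qPochInfR_self hq']
    simp
  · exact .of_forall fun q ↦ by simp

lemma eta_ofReal_mul_I {t : ℝ} (ht : 0 < t) :
    ModularForm.eta (t * Complex.I) =
      (Real.exp (-π * t / 12) * qPochInfR (Real.exp (-2 * π * t)) (Real.exp (-2 * π * t)) : ℝ) := by
  have hq : |Real.exp (-2 * π * t)| < 1 := by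
    rw [abs_of_pos (Real.exp_pos _), Real.exp_lt_one_iff]
    nlinarith [mul_pos pi_pos ht]
  have h1 (h : ℝ) : Function.Periodic.qParam h (t * Complex.I) =
      (Real.exp (-2 * π * t / h) : ℝ) := by
    rw [Function.Periodic.qParam, Complex.ofReal_exp]
    congr 1
    push_cast
    linear_combination (2 * π * t / h : ℂ) * Complex.I_sq
  rw [ModularForm.eta, Complex.ofReal_mul, ofReal_qPochInfR_self hq]
  congr 1
  · have := h1 24
    push_cast at this ⊢
    rw [this]
    congr 1
    ring
  · simp [ModularForm.eta_q, h1]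

/-- The modular inversion of the Dedekind eta function on the imaginary axis. -/
lemma qPochInfR_exp_inversion {t : ℝ} (ht : 0 < t) :
    qPochInfR (Real.exp (-2 * π / t)) (Real.exp (-2 * π / t)) =
      √t * Real.exp ((π / 12) * (1 / t - t)) *
        qPochInfR (Real.exp (-2 * π * t)) (Real.exp (-2 * π * t)) := by
  have hinv := ModularForm.eta_comp_eq_csqrt_I_inv
    (show t * Complex.I ∈ UpperHalfPlane.upperHalfPlaneSet by simpa using ht)
  have harg : -1 / (t * Complex.I) = (t⁻¹ : ℝ) * Complex.I := by
    have : (t : ℂ) ≠ 0 := by exact_mod_cast ht.ne'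
    push_cast
    field_simp
    simp
  have hsqrt : Complex.sqrt (t * Complex.I) = √t * Complex.sqrt Complex.I := by
    have ht' : (t : ℂ) ≠ 0 := by exact_mod_cast ht.ne'
    rw [Real.sqrt_eq_rpow, Complex.ofReal_cpow ht.le, Complex.sqrt, Complex.sqrt,
      Complex.cpow_def_of_ne_zero (mul_ne_zero ht' Complex.I_ne_zero),
      Complex.cpow_def_of_ne_zero Complex.I_ne_zero, Complex.cpow_def_of_ne_zero ht',
      Complex.log_ofReal_mul ht Complex.I_ne_zero, ← Complex.ofReal_log ht.le, ← Complex.exp_add]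
    congr 1
    push_cast
    ring
  have hI : Complex.sqrt Complex.I ≠ 0 := by
    simp [Complex.sqrt]
  simp only [Function.comp_apply, Pi.smul_apply, Pi.mul_apply, smul_eq_mul, harg, hsqrt] at hinv
  rw [eta_ofReal_mul_I ht, eta_ofReal_mul_I (inv_pos.mpr ht), mul_comm (√t : ℂ),
    mul_assoc (Complex.sqrt _), inv_mul_cancel_left₀ hI] at hinv
  have hreal : Real.exp (-π * t⁻¹ / 12) *
      qPochInfR (Real.exp (-2 * π * t⁻¹)) (Real.exp (-2 * π * t⁻¹)) =
      √t * (Real.exp (-π * t / 12) *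
        qPochInfR (Real.exp (-2 * π * t)) (Real.exp (-2 * π * t))) := by
    exact_mod_cast hinv
  have hexp : Real.exp ((π / 12) * (1 / t - t)) =
      (Real.exp (-π * t⁻¹ / 12))⁻¹ * Real.exp (-π * t / 12) := by
    rw [← Real.exp_neg, ← Real.exp_add]
    congr 1
    ring
  have hne := (Real.exp_pos (-π * t⁻¹ / 12)).ne'
  rw [div_eq_mul_inv, hexp]
  refine mul_left_cancel₀ hne (hreal.trans ?_)
  linear_combination -(√t * Real.exp (-π * t / 12) *
    qPochInfR (Real.exp (-2 * π * t)) (Real.exp (-2 * π * t))) * mul_inv_cancel₀ hne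

theorem stmt2 (a γ : ℝ) (ha0 : 0 < a) (ha1 : a < 1) (hγ : 0 < γ) :
    ∃ C > 0, ∃ N : ℕ, 0 < N ∧ ∀ n : ℕ, N ≤ n →
      |qPochInfR (Real.exp (-2 * π / (γ * (n : ℝ) ^ a))) (Real.exp (-2 * π / (γ * (n : ℝ) ^ a))) /
          (Real.sqrt (γ * (n : ℝ) ^ a) *
            Real.exp ((π / 12) * (1 / (γ * (n : ℝ) ^ a) - γ * (n : ℝ) ^ a))) - 1| ≤
        C * Real.exp (-2 * π * γ * (n : ℝ) ^ a) := by
  obtain ⟨C, hC, hbound⟩ := qPochInfR_self_sub_one_isBigO.exists_pos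
  have hpow : Filter.Tendsto (fun n : ℕ ↦ (n : ℝ) ^ a) Filter.atTop Filter.atTop :=
    (tendsto_rpow_atTop ha0).comp tendsto_natCast_atTop_atTop
  have hlim : Filter.Tendsto (fun n : ℕ ↦ Real.exp (-2 * π * (γ * (n : ℝ) ^ a)))
      Filter.atTop (nhds 0) :=
    Real.tendsto_exp_atBot.comp ((hpow.const_mul_atTop hγ).const_mul_atTop_of_neg
      (by linarith [pi_pos]))
  obtain ⟨N, hN⟩ := Filter.eventually_atTop.mp (hlim.eventually hbound.bound)
  refine ⟨C, hC, N + 1, N.succ_pos, fun n hn ↦ ?_⟩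
  have ht : 0 < γ * (n : ℝ) ^ a :=
    mul_pos hγ (Real.rpow_pos_of_pos (by exact_mod_cast (by lia : 0 < n)) a)
  rw [qPochInfR_exp_inversion ht, mul_div_cancel_left₀ _ (by positivity)]
  simpa [mul_assoc] using hN n (by lia)
end

section
/- Fix 0<a<1/2 and u ∈ ℝ; for each positive integer n set q_n := exp(−2π n^{−a}) and P_n := 2·(−1)^n·exp(π n^{−a}(n^a u + n)²) / (√(n^a)·exp(π n^a/12 + π n^{−a}/6)·(1 − exp(−2π n^{−a}))^{n + n^a u + 1/2}). Then there exist C>0 and N such that for all n ≥ N, |1/Γ_{q_n}(1/2 − n − n^a u) − P_n·cos(π n^a u)| ≤ C·exp(−2π n^a)·|P_n|. -/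
open Real

/-- The q-Gamma function `Γ_q(x) = (q;q)_∞ / (q^x;q)_∞ · (1-q)^{1-x}` for real `x`,
with real powers of the positive reals `q` and `1-q`. -/
noncomputable def qGamma (q x : ℝ) : ℝ :=
  qPochInfR q q / qPochInfR (q ^ x) q * (1 - q) ^ (1 - x)

/-- `P_n` from the statement. -/
noncomputable def stmt5P (a u : ℝ) (n : ℕ) : ℝ :=
  2 * (-1 : ℝ) ^ n * Real.exp (π * (n : ℝ) ^ (-a) * ((n : ℝ) ^ a * u + n) ^ 2) /
    (Real.sqrt ((n : ℝ) ^ a) * Real.exp (π * (n : ℝ) ^ a / 12 + π * (n : ℝ) ^ (-a) / 6) *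
      (1 - Real.exp (-2 * π * (n : ℝ) ^ (-a))) ^ ((n : ℝ) + (n : ℝ) ^ a * u + 1 / 2))

lemma exp_neg_two_pi_mul_lt_one {s : ℝ} (hs : 0 < s) : Real.exp (-2 * π * s) < 1 := by
  rw [Real.exp_lt_one_iff]
  linarith [mul_pos Real.pi_pos hs]

lemma exp_neg_two_pi_div_lt_one {t : ℝ} (ht : 0 < t) : Real.exp (-2 * π / t) < 1 := by
  simpa only [div_eq_mul_inv] using exp_neg_two_pi_mul_lt_one (inv_pos.2 ht)

lemma multipliable_qPochInfR (a : ℝ) {q : ℝ} (hq0 : 0 < q) (hq1 : q < 1) :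
    Multipliable fun k : ℕ => 1 - a * q ^ k := by
  have h : Summable fun k : ℕ => -(a * q ^ k) :=
    ((summable_geometric_of_lt_one hq0.le hq1).mul_left a).neg
  simpa only [sub_eq_add_neg] using Real.multipliable_one_add_of_summable h

lemma tendsto_prod_qPochInfR (a : ℝ) {q : ℝ} (hq0 : 0 < q) (hq1 : q < 1) :
    Filter.Tendsto (fun N : ℕ => ∏ k ∈ Finset.range N, (1 - a * q ^ k)) Filter.atTop
      (nhds (qPochInfR a q)) :=
  (multipliable_qPochInfR a hq0 hq1).hasProd.tendsto_prod_nat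

lemma qPochInfR_eq_mul (a : ℝ) {q : ℝ} (hq0 : 0 < q) (hq1 : q < 1) :
    qPochInfR a q = (1 - a) * qPochInfR (a * q) q := by
  refine tendsto_nhds_unique
    ((tendsto_prod_qPochInfR a hq0 hq1).comp (Filter.tendsto_add_atTop_nat 1)) ?_
  convert! (tendsto_prod_qPochInfR (a * q) hq0 hq1).const_mul (1 - a) using 2 with N
  simp only [Function.comp_apply]
  rw [Finset.prod_range_succ', mul_comm]
  simp [pow_succ', mul_assoc]

lemma qPochInfR_mem_Icc {a q : ℝ} (ha0 : 0 ≤ a) (ha1 : a ≤ 1) (hq0 : 0 < q) (hq1 : q < 1) :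
    qPochInfR a q ∈ Set.Icc (1 - a / (1 - q)) 1 := by
  have hs := summable_geometric_of_lt_one hq0.le hq1
  have hmem : ∀ k : ℕ, 0 ≤ a * q ^ k ∧ a * q ^ k ≤ 1 := fun k =>
    ⟨by positivity, mul_le_one₀ ha1 (by positivity) (pow_le_one₀ hq0.le hq1.le)⟩
  constructor
  · refine ge_of_tendsto' (tendsto_prod_qPochInfR a hq0 hq1) fun N => ?_
    have h1 : 1 - ∑ k ∈ Finset.range N, a * q ^ k ≤ ∏ k ∈ Finset.range N, (1 - a * q ^ k) := by
      induction N with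
      | zero => simp
      | succ N ih =>
        rw [Finset.sum_range_succ, Finset.prod_range_succ]
        have h0 : 0 ≤ ∏ k ∈ Finset.range N, (1 - a * q ^ k) :=
          Finset.prod_nonneg fun k _ => by linarith [(hmem k).2]
        have h2 : ∏ k ∈ Finset.range N, (1 - a * q ^ k) ≤ 1 :=
          Finset.prod_le_one (fun k _ => by linarith [(hmem k).2])
            fun k _ => by linarith [(hmem k).1]
        nlinarith [(hmem N).1]
    have h2 : ∑ k ∈ Finset.range N, a * q ^ k ≤ a / (1 - q) := by
      rw [← Finset.mul_sum, div_eq_mul_inv, ← tsum_geometric_of_lt_one hq0.le hq1]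
      exact mul_le_mul_of_nonneg_left (hs.sum_le_tsum _ fun i _ => by positivity) ha0
    linarith
  · exact le_of_tendsto' (tendsto_prod_qPochInfR a hq0 hq1) fun N =>
      Finset.prod_le_one (fun k _ => by linarith [(hmem k).2]) fun k _ => by linarith [(hmem k).1]

lemma one_sub_pow_succ_pos {q : ℝ} (hq0 : 0 < q) (hq1 : q < 1) (k : ℕ) : 0 < 1 - q ^ (k + 1) :=
  sub_pos.2 (pow_lt_one₀ hq0.le hq1 k.succ_ne_zero)

lemma qPochInfR_self_pos {q : ℝ} (hq0 : 0 < q) (hq1 : q < 1) : 0 < qPochInfR q q := by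
  have h1 : ∀ k : ℕ, 0 < 1 - q * q ^ k := fun k => by
    rw [← pow_succ']; exact one_sub_pow_succ_pos hq0 hq1 k
  have hs : Summable fun k : ℕ => Real.log (1 + -(q * q ^ k)) :=
    Real.summable_log_one_add_of_summable
      ((summable_geometric_of_lt_one hq0.le hq1).mul_left q).neg
  rw [qPochInfR, ← Real.rexp_tsum_eq_tprod h1 (by simpa only [sub_eq_add_neg] using hs)]
  exact Real.exp_pos _

/-- The coefficient of `x ^ k` in Euler's expansion of `(x;q)_∞`. -/
noncomputable def eulerCoeff (q : ℝ) (k : ℕ) : ℝ :=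
  ∏ j ∈ Finset.range k, (-q ^ j / (1 - q ^ (j + 1)))

lemma eulerCoeff_succ (q : ℝ) (k : ℕ) :
    eulerCoeff q (k + 1) = eulerCoeff q k * (-q ^ k / (1 - q ^ (k + 1))) :=
  Finset.prod_range_succ _ _

lemma summable_eulerCoeff (x : ℝ) {q : ℝ} (hq0 : 0 < q) (hq1 : q < 1) :
    Summable fun k : ℕ => eulerCoeff q k * x ^ k := by
  have hp : Filter.Tendsto (fun k : ℕ => q ^ k) Filter.atTop (nhds 0) :=
    tendsto_pow_atTop_nhds_zero_of_lt_one hq0.le hq1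
  have hlim : Filter.Tendsto (fun k : ℕ => ‖-q ^ k / (1 - q ^ (k + 1)) * x‖)
      Filter.atTop (nhds 0) := by
    have h := ((hp.neg.div ((hp.comp (Filter.tendsto_add_atTop_nat 1)).const_sub 1)
      (by norm_num)).mul_const x).norm
    simpa using h
  refine summable_of_ratio_norm_eventually_le (r := 1 / 2) (by norm_num) ?_
  filter_upwards [hlim.eventually_le_const (show (0 : ℝ) < 1 / 2 by norm_num)] with k hk
  rw [eulerCoeff_succ, pow_succ x,
    show eulerCoeff q k * (-q ^ k / (1 - q ^ (k + 1))) * (x ^ k * x) =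
      (-q ^ k / (1 - q ^ (k + 1)) * x) * (eulerCoeff q k * x ^ k) by ring, norm_mul]
  exact mul_le_mul_of_nonneg_right hk (norm_nonneg _)

lemma tsum_eulerCoeff_eq_mul (x : ℝ) {q : ℝ} (hq0 : 0 < q) (hq1 : q < 1) :
    ∑' k, eulerCoeff q k * x ^ k = (1 - x) * ∑' k, eulerCoeff q k * (x * q) ^ k := by
  have h1 := summable_eulerCoeff x hq0 hq1
  have h2 := summable_eulerCoeff (x * q) hq0 hq1
  have h3 := h2.mul_left x
  rw [sub_mul, one_mul, ← tsum_mul_left, h1.tsum_eq_zero_add]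
  conv_rhs => rw [h2.tsum_eq_zero_add]
  rw [pow_zero, pow_zero, add_sub_assoc, ← ((summable_nat_add_iff 1).2 h2).tsum_sub h3]
  congr 1
  refine tsum_congr fun k => ?_
  have hk : 1 - q ^ (k + 1) ≠ 0 := (one_sub_pow_succ_pos hq0 hq1 k).ne'
  rw [eulerCoeff_succ, mul_pow, mul_pow]
  field_simp
  ring

/-- Euler's expansion of `(x;q)_∞`. -/
lemma hasSum_eulerCoeff (x : ℝ) {q : ℝ} (hq0 : 0 < q) (hq1 : q < 1) :
    HasSum (fun k : ℕ => eulerCoeff q k * x ^ k) (qPochInfR x q) := by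
  have hfin : ∀ N : ℕ, ∑' k, eulerCoeff q k * x ^ k =
      (∏ k ∈ Finset.range N, (1 - x * q ^ k)) * ∑' k, eulerCoeff q k * (x * q ^ N) ^ k := by
    intro N
    induction N with
    | zero => simp
    | succ N ih =>
      rw [ih, tsum_eulerCoeff_eq_mul (x * q ^ N) hq0 hq1, Finset.prod_range_succ, pow_succ]
      ring_nf
  have hp : Filter.Tendsto (fun N : ℕ => x * q ^ N) Filter.atTop (nhds 0) := by
    simpa using (tendsto_pow_atTop_nhds_zero_of_lt_one hq0.le hq1).const_mul x
  have hlim : Filter.Tendsto (fun N : ℕ => ∑' k, eulerCoeff q k * (x * q ^ N) ^ k) Filter.atTop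
      (nhds (∑' k, eulerCoeff q k * 0 ^ k)) := by
    refine tendsto_tsum_of_dominated_convergence (summable_eulerCoeff x hq0 hq1).norm
      (fun k => (hp.pow k).const_mul _) (Filter.Eventually.of_forall fun N k => ?_)
    rw [norm_mul, norm_mul, norm_pow, norm_pow, norm_mul]
    gcongr
    refine mul_le_of_le_one_right (norm_nonneg _) ?_
    rw [Real.norm_of_nonneg (pow_nonneg hq0.le N)]
    exact pow_le_one₀ hq0.le hq1.le
  have h0 : ∑' k, eulerCoeff q k * 0 ^ k = 1 := by
    rw [tsum_eq_single 0 (fun k hk => by simp [hk])]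
    simp [eulerCoeff]
  have h := (tendsto_prod_qPochInfR x hq0 hq1).mul hlim
  rw [h0, mul_one] at h
  rw [← tendsto_nhds_unique (tendsto_const_nhds.congr hfin) h]
  exact (summable_eulerCoeff x hq0 hq1).hasSum

/-- The Gaussian term `exp (-π j² / t + 2 π u j)` of a two-sided theta series. -/
noncomputable def gaussTerm (t u : ℝ) (j : ℤ) : ℝ :=
  Real.exp (-π / t * (j : ℝ) ^ 2 + 2 * π * u * j)

lemma eulerCoeff_mul_pow_eq {t u q : ℝ} (ht : 0 < t) (hq : q = Real.exp (-2 * π / t)) (n k : ℕ) :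
    eulerCoeff q k * Real.exp (-2 * π / t * (1 / 2 - n) + 2 * π * u) ^ k * qPochInfR q q =
      (-1) ^ n * Real.exp (π / t * n ^ 2 + 2 * π * u * n) *
        ((-1) ^ (n + k) * gaussTerm t u (k - n) * qPochInfR (q ^ (k + 1)) q) := by
  have hq0 : 0 < q := hq ▸ Real.exp_pos _
  have hq1 : q < 1 := hq ▸ exp_neg_two_pi_div_lt_one ht
  induction k with
  | zero =>
    simp only [eulerCoeff, gaussTerm, Finset.range_zero, Finset.prod_empty, pow_zero, add_zero]
    have h1 : ((-1 : ℝ) ^ n) * (-1) ^ n = 1 := by rw [← mul_pow]; norm_num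
    have h2 : Real.exp (π / t * n ^ 2 + 2 * π * u * n) *
        Real.exp (-π / t * (((0 : ℕ) - n : ℤ) : ℝ) ^ 2 + 2 * π * u * ((0 : ℕ) - n : ℤ)) = 1 := by
      rw [← Real.exp_add, Real.exp_eq_one_iff]
      push_cast
      ring
    rw [zero_add, pow_one]
    linear_combination (-((-1 : ℝ) ^ n * (-1) ^ n) * qPochInfR q q) * h2 - qPochInfR q q * h1
  | succ k ih =>
    have hk := (one_sub_pow_succ_pos hq0 hq1 k).ne'
    have h1 : qPochInfR (q ^ (k + 1)) q =
        (1 - q ^ (k + 1)) * qPochInfR (q ^ (k + 1 + 1)) q := by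
      rw [qPochInfR_eq_mul _ hq0 hq1, ← pow_succ]
    have h2 : gaussTerm t u ((k + 1 : ℕ) - n) = gaussTerm t u (k - n) * q ^ k *
        Real.exp (-2 * π / t * (1 / 2 - n) + 2 * π * u) := by
      rw [gaussTerm, gaussTerm, hq, ← Real.exp_nat_mul, ← Real.exp_add, ← Real.exp_add]
      congr 1
      push_cast
      field_simp
      ring
    rw [h1] at ih
    rw [eulerCoeff_succ, h2, pow_succ (Real.exp _) k, ← add_assoc, pow_succ _ (n + k)]
    rw [show ∀ A B C D : ℝ, A * (-q ^ k / (1 - q ^ (k + 1))) * (B * C) * D =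
      (A * B * D) * (-q ^ k / (1 - q ^ (k + 1)) * C) by intros; ring, ih]
    field_simp

/-- The factor `(q^{n+j+1};q)_∞`, extended by zero, by which the bilateral expansion of
`(q;q)_∞ (q^{1/2-n} w;q)_∞` differs from a theta series. -/
noncomputable def thetaWeight (q : ℝ) (n : ℕ) (j : ℤ) : ℝ :=
  if 0 ≤ j + n then qPochInfR (q ^ ((j + n).toNat + 1)) q else 0

lemma abs_thetaWeight_sub_one_le {q : ℝ} (hq0 : 0 < q) (hq1 : q < 1) (n : ℕ) (j : ℤ) :
    |thetaWeight q n j - 1| ≤ q ^ (n + 1) / (1 - q) * q ^ j := by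
  have h1q : 0 < 1 - q := sub_pos.2 hq1
  have he : q ^ (n + 1) / (1 - q) * q ^ j = q ^ (j + n + 1) / (1 - q) := by
    rw [zpow_add₀ hq0.ne', zpow_add₀ hq0.ne', pow_succ, zpow_natCast, zpow_one]
    ring
  rw [he, thetaWeight]
  split_ifs with h
  · obtain ⟨m, hm⟩ := Int.eq_ofNat_of_zero_le h
    obtain ⟨hl, hu⟩ := qPochInfR_mem_Icc (a := q ^ (m + 1)) (by positivity)
      (pow_le_one₀ hq0.le hq1.le) hq0 hq1
    rw [hm, Int.toNat_natCast, abs_sub_comm, abs_of_nonneg (by linarith),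
      show q ^ ((m : ℤ) + 1) = q ^ (m + 1) from zpow_natCast q (m + 1)]
    linarith
  · rw [zero_sub, abs_neg, abs_one, le_div_iff₀ h1q]
    have : (1 : ℝ) ≤ q ^ (j + n + 1) := one_le_zpow_of_nonpos₀ hq0 hq1.le (by omega)
    linarith

lemma hasSum_thetaWeight {t u q : ℝ} (ht : 0 < t) (hq : q = Real.exp (-2 * π / t)) (n : ℕ) :
    HasSum (fun j : ℤ => (-1) ^ n * Real.exp (π / t * n ^ 2 + 2 * π * u * n) *
        ((-1) ^ j * gaussTerm t u j * thetaWeight q n j))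
      (qPochInfR (Real.exp (-2 * π / t * (1 / 2 - n) + 2 * π * u)) q * qPochInfR q q) := by
  have hq0 : 0 < q := hq ▸ Real.exp_pos _
  have hq1 : q < 1 := hq ▸ exp_neg_two_pi_div_lt_one ht
  have hinj : Function.Injective fun k : ℕ => (k : ℤ) - n := fun a b h => by simpa using h
  rw [← hinj.hasSum_iff]
  · convert! (hasSum_eulerCoeff (Real.exp (-2 * π / t * (1 / 2 - n) + 2 * π * u))
      hq0 hq1).mul_right (qPochInfR q q) using 2 with k
    rw [eulerCoeff_mul_pow_eq ht hq, Function.comp_apply, thetaWeight, sub_add_cancel,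
      if_pos (Int.natCast_nonneg k), Int.toNat_natCast, zpow_sub₀ (by norm_num : (-1 : ℝ) ≠ 0),
      zpow_natCast, zpow_natCast, pow_add (-1 : ℝ)]
    rcases neg_one_pow_eq_or ℝ n with h | h <;> rw [h] <;> ring
  · intro j hj
    have : ¬ 0 ≤ j + n := fun h => hj ⟨(j + n).toNat, by simp [Int.toNat_of_nonneg h]⟩
    simp [thetaWeight, this]

lemma norm_eta_mul_I {s : ℝ} (hs : 0 < s) :
    ‖ModularForm.eta (s * Complex.I)‖ = Real.exp (-π * s / 12) *
      qPochInfR (Real.exp (-2 * π * s)) (Real.exp (-2 * π * s)) := by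
  have hpos := qPochInfR_self_pos (Real.exp_pos _) (exp_neg_two_pi_mul_lt_one hs)
  have h1 : ∏' n, (1 - ModularForm.eta_q n (s * Complex.I)) =
      ((qPochInfR (Real.exp (-2 * π * s)) (Real.exp (-2 * π * s)) : ℝ) : ℂ) := by
    refine Eq.trans ?_ ((multipliable_qPochInfR (Real.exp (-2 * π * s)) (Real.exp_pos _)
      (exp_neg_two_pi_mul_lt_one hs)).map_tprod Complex.ofRealHom Complex.continuous_ofReal).symm
    refine tprod_congr fun n => ?_
    rw [ModularForm.eta_q_eq_pow, ← pow_succ', Complex.ofRealHom_eq_coe]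
    push_cast
    congr 3
    linear_combination (2 * π * s : ℂ) * Complex.I_sq
  rw [ModularForm.eta, h1, norm_mul, Complex.norm_real, Real.norm_of_nonneg hpos.le,
    Function.Periodic.norm_qParam]
  congr 2
  simp
  ring

lemma qPochInfR_self_sq {t : ℝ} (ht : 0 < t) :
    qPochInfR (Real.exp (-2 * π / t)) (Real.exp (-2 * π / t)) ^ 2 =
      t * Real.exp (π / (6 * t) - π * t / 6) *
        qPochInfR (Real.exp (-2 * π * t)) (Real.exp (-2 * π * t)) ^ 2 := by
  have hz : 0 < ((t : ℂ) * Complex.I).im := by simpa using ht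
  have h := congrArg norm (ModularForm.eta_comp_eq_csqrt_I_inv hz)
  have h1 : -1 / ((t : ℂ) * Complex.I) = ((1 / t : ℝ) : ℂ) * Complex.I := by
    have : (t : ℂ) ≠ 0 := by exact_mod_cast ht.ne'
    push_cast
    field_simp
    rw [Complex.I_sq]
  have h2 : ∀ z : ℂ, ‖Complex.sqrt z‖ = √‖z‖ := fun z => by
    have hsq : Complex.sqrt z ^ 2 = z := Complex.cpow_nat_inv_pow z two_ne_zero
    rw [← Real.sqrt_sq (norm_nonneg (Complex.sqrt z)), ← norm_pow, hsq]
  simp only [Function.comp_apply, Pi.smul_apply, Pi.mul_apply, smul_eq_mul] at h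
  rw [h1, norm_eta_mul_I (by positivity), norm_mul, norm_mul, norm_inv, norm_eta_mul_I ht,
    h2, h2, norm_mul, Complex.norm_I, mul_one,
    Complex.norm_real, Real.norm_of_nonneg ht.le, Real.sqrt_one, inv_one, one_mul,
    mul_one_div, mul_one_div] at h
  have h3 := congrArg (fun x => x ^ 2) h
  simp only [mul_pow, Real.sq_sqrt ht.le, ← Real.exp_nat_mul] at h3
  have h4 : Real.exp (π / (6 * t) - π * t / 6) =
      Real.exp ((2 : ℕ) * (-π * t / 12)) / Real.exp ((2 : ℕ) * (-π / t / 12)) := by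
    rw [← Real.exp_sub]
    congr 1
    push_cast
    field_simp
    ring
  rw [h4, mul_div_assoc', div_mul_eq_mul_div, eq_div_iff (Real.exp_pos _).ne', mul_assoc t, ← h3,
    mul_comm]

lemma summable_gaussTerm {t : ℝ} (ht : 0 < t) (u : ℝ) : Summable (gaussTerm t u) := by
  have h := ((summable_jacobiTheta₂_term_iff (-(u * Complex.I)) ((1 / t : ℝ) * Complex.I)).2
    (by simpa using ht)).norm
  refine h.congr fun j => ?_
  rw [norm_jacobiTheta₂_term, gaussTerm]
  congr 1
  simp
  ring

lemma tsum_cexp_gauss_eq {t : ℝ} (ht : 0 < t) (b : ℂ) :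
    ∑' n : ℤ, Complex.exp (-π * (1 / t : ℝ) * n ^ 2 + 2 * π * b * n) =
      (√t : ℝ) * ∑' n : ℤ, Complex.exp (-π * t * (n + Complex.I * b) ^ 2) := by
  have h1 : (((1 / t : ℝ) : ℂ)) ^ (1 / 2 : ℂ) = ((√t)⁻¹ : ℝ) := by
    rw [show (1 / 2 : ℂ) = ((1 / 2 : ℝ) : ℂ) by push_cast; rfl,
      ← Complex.ofReal_cpow (by positivity), ← Real.sqrt_eq_rpow, one_div, Real.sqrt_inv]
  rw [Complex.tsum_exp_neg_quadratic (by simpa using ht), h1]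
  congr 1
  · push_cast
    rw [one_div, inv_inv]
  · refine tsum_congr fun n => ?_
    push_cast
    rw [one_div, div_inv_eq_mul]

lemma norm_cexp_gauss (t u β : ℝ) (n : ℤ) :
    ‖Complex.exp (-π * t * (n + Complex.I * (u + β * Complex.I)) ^ 2)‖ =
      Real.exp (π * t * u ^ 2) * Real.exp (-π * t * (n - β) ^ 2) := by
  rw [Complex.norm_exp, ← Real.exp_add]
  congr 1
  have : (-π * t * (n + Complex.I * (u + β * Complex.I)) ^ 2 : ℂ) =
      ((π * t * u ^ 2 + -π * t * (n - β) ^ 2 : ℝ) : ℂ) +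
        ((-2 * π * t * (n - β) * u : ℝ) : ℂ) * Complex.I := by
    push_cast
    linear_combination (-π * t * (2 * β * n - β ^ 2 + u ^ 2 + 2 * u * β * Complex.I + β ^ 2 * (Complex.I ^ 2)) : ℂ) * Complex.I_sq
  rw [this, Complex.add_re, Complex.ofReal_re, Complex.re_ofReal_mul, Complex.I_re, mul_zero,
    add_zero]

lemma exists_tsum_gaussTerm_le : ∃ C > 0, ∀ t u : ℝ, 1 ≤ t →
    ∑' j, gaussTerm t u j ≤ C * (√t * Real.exp (π * t * u ^ 2)) := by
  have hs := summable_gaussTerm one_pos 0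
  refine ⟨∑' j, gaussTerm 1 0 j, hs.tsum_pos (fun j => (Real.exp_pos _).le) 0 (Real.exp_pos _),
    fun t u ht => ?_⟩
  have h := tsum_cexp_gauss_eq (by linarith : 0 < t) u
  have h1 : ((∑' j, gaussTerm t u j : ℝ) : ℂ) =
      ∑' n : ℤ, Complex.exp (-π * (1 / t : ℝ) * n ^ 2 + 2 * π * u * n) := by
    rw [Complex.ofReal_tsum]
    refine tsum_congr fun n => ?_
    rw [gaussTerm]
    push_cast
    ring_nf
  have h2 : ‖∑' n : ℤ, Complex.exp (-π * t * (n + Complex.I * u) ^ 2)‖ ≤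
      Real.exp (π * t * u ^ 2) * ∑' j, gaussTerm 1 0 j := by
    refine tsum_of_norm_bounded (hs.hasSum.mul_left _) fun n => ?_
    have h3 := norm_cexp_gauss t u 0 n
    simp only [Complex.ofReal_zero, zero_mul, add_zero, sub_zero] at h3
    rw [h3, gaussTerm]
    gcongr
    have := mul_nonneg (mul_nonneg Real.pi_pos.le (sub_nonneg.2 ht)) (sq_nonneg (n : ℝ))
    linarith
  have h4 : ∑' j, gaussTerm t u j ≤ ‖((∑' j, gaussTerm t u j : ℝ) : ℂ)‖ := by
    rw [Complex.norm_real]; exact le_abs_self _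
  refine h4.trans ?_
  rw [h1, h, norm_mul, Complex.norm_real, Real.norm_of_nonneg (Real.sqrt_nonneg t)]
  calc √t * _ ≤ √t * (Real.exp (π * t * u ^ 2) * ∑' j, gaussTerm 1 0 j) := by gcongr
    _ = _ := by ring

lemma ofReal_tsum_neg_one_zpow_mul_gaussTerm (t u : ℝ) :
    ((∑' j : ℤ, (-1) ^ j * gaussTerm t u j : ℝ) : ℂ) =
      ∑' n : ℤ, Complex.exp (-π * (1 / t : ℝ) * n ^ 2 +
        2 * π * (u + (1 / 2 : ℝ) * Complex.I) * n) := by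
  rw [Complex.ofReal_tsum]
  refine tsum_congr fun n => ?_
  have : (-1 : ℂ) ^ n = Complex.exp (n * (π * Complex.I)) := by
    rw [Complex.exp_int_mul, Complex.exp_pi_mul_I]
  rw [gaussTerm]
  push_cast
  rw [this, ← Complex.exp_add]
  ring_nf

lemma exists_abs_tsum_neg_one_zpow_mul_gaussTerm_sub_le : ∃ C > 0, ∀ t u : ℝ, 1 ≤ t →
    |∑' j : ℤ, (-1) ^ j * gaussTerm t u j -
        2 * √t * Real.exp (π * t * u ^ 2 - π * t / 4) * Real.cos (π * t * u)| ≤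
      C * (√t * Real.exp (π * t * u ^ 2 - π * t / 4)) * Real.exp (-2 * π * t) := by
  have hs : Summable fun j => Real.exp (2 * π) * gaussTerm 1 (1 / 2) j :=
    (summable_gaussTerm one_pos (1 / 2)).mul_left _
  let s : Finset ℤ := {0, 1}
  have h2s : (2 : ℤ) ∉ s := by decide
  have hs' := hs.subtype {x | x ∉ s}
  refine ⟨∑' j : {x // x ∉ s}, Real.exp (2 * π) * gaussTerm 1 (1 / 2) j,
    hs'.tsum_pos (fun j => (mul_pos (Real.exp_pos _) (Real.exp_pos _)).le) ⟨2, h2s⟩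
      (mul_pos (Real.exp_pos _) (Real.exp_pos _)), fun t u ht => ?_⟩
  have ht0 : 0 < t := by linarith
  let T : ℤ → ℂ := fun n =>
    Complex.exp (-π * t * (n + Complex.I * (u + (1 / 2 : ℝ) * Complex.I)) ^ 2)
  have hT : Summable T := by
    refine Summable.of_norm (((summable_gaussTerm (inv_pos.2 ht0) (t / 2)).mul_left
      (Real.exp (π * t * u ^ 2 - π * t / 4))).congr fun n => ?_)
    rw [norm_cexp_gauss, gaussTerm, ← Real.exp_add, ← Real.exp_add]
    congr 1
    field_simp
    ring
  have hsum := ofReal_tsum_neg_one_zpow_mul_gaussTerm t u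
  rw [tsum_cexp_gauss_eq ht0, ← hT.sum_add_tsum_subtype_compl s] at hsum
  have hmain : ∑ n ∈ s, T n =
      ((2 * Real.exp (π * t * u ^ 2 - π * t / 4) * Real.cos (π * t * u) : ℝ) : ℂ) := by
    rw [Finset.sum_pair (by norm_num)]
    push_cast
    rw [mul_right_comm, Complex.two_cos, add_mul, ← Complex.exp_add, ← Complex.exp_add]
    simp only [T]
    congr 2 <;> push_cast
    · linear_combination (-π * t * (u ^ 2 + u * Complex.I + (Complex.I ^ 2 - 1) / 4) : ℂ) *
        Complex.I_sq
    · linear_combination (-π * t * (1 + u ^ 2 + u * Complex.I + (Complex.I ^ 2 - 1) / 4) : ℂ) *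
        Complex.I_sq
  have htail : ‖∑' n : {x // x ∉ s}, T n‖ ≤
      Real.exp (π * t * u ^ 2 - π * t / 4 + -2 * π * t) *
        ∑' j : {x // x ∉ s}, Real.exp (2 * π) * gaussTerm 1 (1 / 2) j := by
    refine tsum_of_norm_bounded (hs'.hasSum.mul_left _) fun n => ?_
    obtain ⟨n, hn⟩ := n
    have h2 : (0 : ℝ) ≤ (n - 2) * (n + 1) := by
      have : (0 : ℤ) ≤ (n - 2) * (n + 1) := by
        simp only [s, Finset.mem_insert, Finset.mem_singleton, not_or] at hn
        rcases lt_or_ge n 0 with h | h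
        · exact mul_nonneg_of_nonpos_of_nonpos (by omega) (by omega)
        · exact mul_nonneg (by omega) (by omega)
      exact_mod_cast this
    simp only [T, Function.comp_apply]
    rw [norm_cexp_gauss, gaussTerm, ← Real.exp_add, ← Real.exp_add, ← Real.exp_add,
      Real.exp_le_exp]
    have := mul_nonneg (mul_nonneg Real.pi_pos.le (sub_nonneg.2 ht)) h2
    nlinarith
  rw [← Real.norm_eq_abs, ← Complex.norm_real, Complex.ofReal_sub, hsum, hmain, mul_add,
    show 2 * √t * Real.exp (π * t * u ^ 2 - π * t / 4) * Real.cos (π * t * u) =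
      √t * (2 * Real.exp (π * t * u ^ 2 - π * t / 4) * Real.cos (π * t * u)) by ring,
    Complex.ofReal_mul (√t), add_sub_cancel_left, norm_mul, Complex.norm_real,
    Real.norm_of_nonneg (Real.sqrt_nonneg t)]
  refine (mul_le_mul_of_nonneg_left htail (Real.sqrt_nonneg t)).trans_eq ?_
  rw [Real.exp_add]
  ring

lemma abs_tsum_thetaWeight_sub_le {t u q : ℝ} (ht : 0 < t) (hq : q = Real.exp (-2 * π / t))
    (n : ℕ) :
    |∑' j : ℤ, (-1) ^ j * gaussTerm t u j * thetaWeight q n j -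
        ∑' j : ℤ, (-1) ^ j * gaussTerm t u j| ≤
      q ^ (n + 1) / (1 - q) * ∑' j, gaussTerm t (u - 1 / t) j := by
  have hq0 : 0 < q := hq ▸ Real.exp_pos _
  have hq1 : q < 1 := hq ▸ exp_neg_two_pi_div_lt_one ht
  have hc : (-1) ^ n * Real.exp (π / t * n ^ 2 + 2 * π * u * n) ≠ 0 :=
    mul_ne_zero (pow_ne_zero _ (by norm_num)) (Real.exp_pos _).ne'
  have hs := (summable_mul_left_iff hc).1 (hasSum_thetaWeight (u := u) ht hq n).summable
  have habs : ∀ j : ℤ, |(-1 : ℝ) ^ j| = 1 := fun j => by rw [abs_zpow, abs_neg, abs_one, one_zpow]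
  have hs' : Summable fun j : ℤ => (-1) ^ j * gaussTerm t u j := by
    refine Summable.of_norm ((summable_gaussTerm ht u).congr fun j => ?_)
    rw [norm_mul, Real.norm_eq_abs, habs, one_mul, gaussTerm,
      Real.norm_of_nonneg (Real.exp_pos _).le]
  rw [← hs.tsum_sub hs', ← Real.norm_eq_abs]
  refine tsum_of_norm_bounded ((summable_gaussTerm ht (u - 1 / t)).hasSum.mul_left _) fun j => ?_
  have hg : gaussTerm t (u - 1 / t) j = gaussTerm t u j * q ^ j := by
    rw [gaussTerm, gaussTerm, hq, ← Real.rpow_intCast, ← Real.exp_mul, ← Real.exp_add]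
    congr 1
    field_simp
    ring
  have hpos : 0 ≤ gaussTerm t u j := (Real.exp_pos _).le
  rw [← mul_sub_one, norm_mul, norm_mul, Real.norm_eq_abs, habs, one_mul, hg,
    Real.norm_of_nonneg hpos, Real.norm_eq_abs, mul_left_comm]
  exact mul_le_mul_of_nonneg_left (abs_thetaWeight_sub_one_le hq0 hq1 n j) hpos

lemma pow_succ_div_one_sub_mul_exp_le {t : ℝ} (u : ℝ) {q : ℝ} (ht : 1 ≤ t)
    (hq : q = Real.exp (-2 * π / t)) {n : ℕ} (hn : 2 * t ^ 2 ≤ n) :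
    q ^ (n + 1) / (1 - q) * Real.exp (π * t * (u - 1 / t) ^ 2) ≤
      Real.exp (2 * π * |u| + π) * Real.exp (π * t * u ^ 2 - π * t / 4) *
        Real.exp (-2 * π * t) := by
  have ht0 : 0 < t := by linarith
  have hq0 : 0 < q := hq ▸ Real.exp_pos _
  have hq1 : q < 1 := hq ▸ exp_neg_two_pi_div_lt_one ht0
  have h1 : q / (1 - q) ≤ Real.exp t := by
    rw [div_le_iff₀ (sub_pos.2 hq1)]
    have h2 : 2 * π / t + 1 ≤ q⁻¹ := by
      rw [hq, ← Real.exp_neg, show -(-2 * π / t) = 2 * π / t by ring]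
      exact Real.add_one_le_exp _
    have h3 : (2 * π / t + 1) * q ≤ 1 := by
      have := mul_le_mul_of_nonneg_right h2 hq0.le
      rwa [inv_mul_cancel₀ hq0.ne'] at this
    have h4 : 2 * π * q ≤ t * (1 - q) := by
      have h5 : 2 * π / t * t = 2 * π := by field_simp
      nlinarith [mul_le_mul_of_nonneg_left h3 ht0.le]
    have h6 : q ≤ t * (1 - q) := by nlinarith [Real.pi_gt_three]
    exact h6.trans (mul_le_mul_of_nonneg_right (by linarith [Real.add_one_le_exp t])
      (sub_pos.2 hq1).le)
  have h2 : q ^ n = Real.exp (-2 * π * (n / t)) := by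
    rw [hq, ← Real.exp_nat_mul]
    congr 1
    ring
  calc q ^ (n + 1) / (1 - q) * Real.exp (π * t * (u - 1 / t) ^ 2)
      = q ^ n * (q / (1 - q)) * Real.exp (π * t * (u - 1 / t) ^ 2) := by ring
    _ ≤ q ^ n * Real.exp t * Real.exp (π * t * (u - 1 / t) ^ 2) := by gcongr
    _ = Real.exp (-2 * π * (n / t) + t + π * t * (u - 1 / t) ^ 2) := by
      rw [h2, Real.exp_add, Real.exp_add]
    _ ≤ Real.exp (2 * π * |u| + π + (π * t * u ^ 2 - π * t / 4) + -2 * π * t) := by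
      rw [Real.exp_le_exp]
      have h3 : 2 * t ≤ n / t := by rw [le_div_iff₀ ht0]; linarith
      have h4 : π * t * (u - 1 / t) ^ 2 = π * t * u ^ 2 - 2 * (π * u) + π * (1 / t) := by
        field_simp
        ring
      have h5 : π * (1 / t) ≤ π * 1 :=
        mul_le_mul_of_nonneg_left ((div_le_one ht0).2 ht) Real.pi_pos.le
      have h6 := mul_le_mul_of_nonneg_left (neg_abs_le u) Real.pi_pos.le
      have h7 := mul_le_mul_of_nonneg_left h3 Real.pi_pos.le
      have h8 := mul_le_mul_of_nonneg_right Real.pi_gt_three.le ht0.le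
      rw [h4]
      nlinarith
    _ = _ := by rw [Real.exp_add, Real.exp_add]

lemma abs_div_sq_sub_le {c δ Q e D : ℝ} (hc : |c| ≤ 1) (hδ : |δ| ≤ D * e) (hQ : 1 - 2 * e ≤ Q)
    (hQ1 : Q ≤ 1) (he : e ≤ 1 / 4) : |(c + δ) / Q ^ 2 - c| ≤ (4 * D + 16) * e := by
  have hQ2 : 1 / 2 ≤ Q := by linarith
  have hQ4 : 1 / 4 ≤ Q ^ 2 := by nlinarith
  have h1 : (c + δ) / Q ^ 2 - c = (δ + c * (1 - Q ^ 2)) / Q ^ 2 := by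
    field_simp
    ring
  have h2 : |δ + c * (1 - Q ^ 2)| ≤ D * e + 4 * e := by
    refine (abs_add_le _ _).trans (add_le_add hδ ?_)
    have h0 : 0 ≤ 1 - Q ^ 2 := by nlinarith
    rw [abs_mul, abs_of_nonneg h0]
    exact (mul_le_of_le_one_left h0 hc).trans (by nlinarith)
  rw [h1, abs_div, abs_of_pos (by positivity : 0 < Q ^ 2), div_le_iff₀ (by positivity)]
  nlinarith [abs_nonneg (δ + c * (1 - Q ^ 2))]

lemma exp_neg_two_pi_mul_le {t : ℝ} (ht : 1 ≤ t) : Real.exp (-2 * π * t) ≤ 1 / 4 := by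
  rw [show -2 * π * t = -(2 * π * t) by ring, Real.exp_neg, one_div]
  refine inv_anti₀ (by norm_num) ?_
  nlinarith [Real.add_one_le_exp (2 * π * t), Real.pi_gt_three]

lemma exists_abs_qPochInfR_div_sub_le (u : ℝ) : ∃ C > 0, ∀ (t q M : ℝ) (n : ℕ), 1 ≤ t →
    2 * t ^ 2 ≤ n → q = Real.exp (-2 * π / t) →
    M = 2 * (-1) ^ n * Real.exp (π / t * (t * u + n) ^ 2) /
      (√t * Real.exp (π * t / 12 + π / (6 * t))) →
    |qPochInfR (Real.exp (-2 * π / t * (1 / 2 - n) + 2 * π * u)) q / qPochInfR q q -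
        M * Real.cos (π * t * u)| ≤ C * Real.exp (-2 * π * t) * |M| := by
  obtain ⟨C₀, hC₀, h₀⟩ := exists_abs_tsum_neg_one_zpow_mul_gaussTerm_sub_le
  obtain ⟨C₁, hC₁, h₁⟩ := exists_tsum_gaussTerm_le
  let D : ℝ := C₀ + C₁ * Real.exp (2 * π * |u| + π)
  refine ⟨4 * D + 16, by positivity, fun t q M n ht hn hq hM => ?_⟩
  have ht0 : 0 < t := by linarith
  have hq0 : 0 < q := hq ▸ Real.exp_pos _
  have hq1 : q < 1 := hq ▸ exp_neg_two_pi_div_lt_one ht0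
  set S : ℝ := ∑' j : ℤ, (-1) ^ j * gaussTerm t u j * thetaWeight q n j
  set W : ℝ := √t * Real.exp (π * t * u ^ 2 - π * t / 4) with hW
  have hW0 : 0 < W := by positivity
  set e : ℝ := Real.exp (-2 * π * t) with he
  have he4 : e ≤ 1 / 4 := exp_neg_two_pi_mul_le ht
  have he0 : 0 < e := Real.exp_pos _
  set c : ℝ := Real.cos (π * t * u)
  have hS : |S - 2 * W * c| ≤ D * W * e := by
    have hθ := h₀ t u ht
    have hw := abs_tsum_thetaWeight_sub_le (u := u) ht0 hq n
    have hg := h₁ t (u - 1 / t) ht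
    have hp := pow_succ_div_one_sub_mul_exp_le u ht hq hn
    have h1q : 0 < 1 - q := sub_pos.2 hq1
    have hw' : q ^ (n + 1) / (1 - q) * ∑' j, gaussTerm t (u - 1 / t) j ≤
        C₁ * Real.exp (2 * π * |u| + π) * W * e := by
      calc _ ≤ q ^ (n + 1) / (1 - q) * (C₁ * (√t * Real.exp (π * t * (u - 1 / t) ^ 2))) := by
            gcongr
        _ = C₁ * √t * (q ^ (n + 1) / (1 - q) * Real.exp (π * t * (u - 1 / t) ^ 2)) := by ring
        _ ≤ C₁ * √t * _ := mul_le_mul_of_nonneg_left hp (by positivity)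
        _ = _ := by rw [hW]; ring
    rw [mul_assoc 2 (√t), ← hW] at hθ
    calc _ ≤ _ := abs_sub_le S (∑' j : ℤ, (-1) ^ j * gaussTerm t u j) (2 * W * c)
      _ ≤ C₁ * Real.exp (2 * π * |u| + π) * W * e + C₀ * W * e :=
        add_le_add (hw.trans hw') hθ
      _ = _ := by ring
  set Q : ℝ := qPochInfR (Real.exp (-2 * π * t)) (Real.exp (-2 * π * t)) with hQ
  have hQmem := qPochInfR_mem_Icc he0.le (by linarith) he0 (by linarith : e < 1)
  have hQ1 : 1 - 2 * e ≤ Q := by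
    refine le_trans ?_ hQmem.1
    have : e / (1 - e) ≤ 2 * e := by
      rw [div_le_iff₀ (by linarith)]
      nlinarith
    linarith
  have hQ0 : 0 < Q := by linarith
  have hA := (hasSum_thetaWeight (u := u) ht0 hq n).tsum_eq
  rw [tsum_mul_left] at hA
  have hqq := qPochInfR_self_sq ht0
  rw [← hq, ← hQ] at hqq
  have hM' : (-1) ^ n * Real.exp (π / t * n ^ 2 + 2 * π * u * n) =
      M * (t * Real.exp (π / (6 * t) - π * t / 6)) / (2 * W) := by
    have hexp : Real.exp (π / t * n ^ 2 + 2 * π * u * n) *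
        Real.exp (π * t * u ^ 2 - π * t / 4) * Real.exp (π * t / 12 + π / (6 * t)) =
        Real.exp (π / t * (t * u + n) ^ 2) * Real.exp (π / (6 * t) - π * t / 6) := by
      rw [← Real.exp_add, ← Real.exp_add, ← Real.exp_add]
      congr 1
      field_simp
      ring
    rw [hM, hW, eq_div_iff (by positivity),
      div_mul_eq_mul_div (2 * (-1) ^ n * Real.exp (π / t * (t * u + n) ^ 2)),
      eq_div_iff (by positivity)]
    linear_combination (2 * (-1) ^ n * √t ^ 2) * hexp + (2 * (-1) ^ n *
      Real.exp (π / t * (t * u + n) ^ 2) * Real.exp (π / (6 * t) - π * t / 6)) * Real.sq_sqrt ht0.le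
  have hqpos := qPochInfR_self_pos hq0 hq1
  have hratio : qPochInfR (Real.exp (-2 * π / t * (1 / 2 - n) + 2 * π * u)) q / qPochInfR q q =
      M * ((c + (S / (2 * W) - c)) / Q ^ 2) := by
    calc _ = qPochInfR (Real.exp (-2 * π / t * (1 / 2 - n) + 2 * π * u)) q * qPochInfR q q /
          qPochInfR q q ^ 2 := by field_simp
      _ = _ := by
        rw [← hA, hM', hqq]
        field_simp
        ring
  rw [hratio, ← mul_sub, abs_mul, mul_comm]
  refine mul_le_mul_of_nonneg_right (abs_div_sq_sub_le (Real.abs_cos_le_one _) ?_ hQ1 hQmem.2 he4)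
    (abs_nonneg _)
  have h3 : S / (2 * W) - c = (S - 2 * W * c) / (2 * W) := by field_simp
  rw [h3, abs_div, abs_of_pos (by positivity : 0 < 2 * W), div_le_iff₀ (by positivity)]
  have : 0 < D * W * e := by positivity
  linarith

lemma eventually_two_mul_rpow_sq_le {a : ℝ} (ha : a < 1 / 2) :
    ∀ᶠ n : ℕ in Filter.atTop, 2 * ((n : ℝ) ^ a) ^ 2 ≤ n := by
  have h := ((tendsto_rpow_atTop (by linarith : 0 < 1 - 2 * a)).comp
    tendsto_natCast_atTop_atTop).eventually_ge_atTop 2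
  filter_upwards [h, Filter.eventually_gt_atTop 0] with n hn hn0
  have hn0' : (0 : ℝ) < n := by exact_mod_cast hn0
  have hn' : 2 ≤ (n : ℝ) ^ (1 - 2 * a) := hn
  have hsplit : (n : ℝ) ^ (1 - 2 * a) * ((n : ℝ) ^ a) ^ 2 = n := by
    rw [← Real.rpow_natCast ((n : ℝ) ^ a) 2, ← Real.rpow_mul hn0'.le, ← Real.rpow_add hn0',
      Nat.cast_ofNat, show 1 - 2 * a + a * 2 = 1 by ring, Real.rpow_one]
  exact (mul_le_mul_of_nonneg_right hn' (by positivity)).trans_eq hsplit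

theorem stmt5 (a u : ℝ) (ha0 : 0 < a) (ha1 : a < 1 / 2) :
    ∃ C > 0, ∃ N : ℕ, 0 < N ∧ ∀ n : ℕ, N ≤ n →
      |1 / qGamma (Real.exp (-2 * π * (n : ℝ) ^ (-a))) (1 / 2 - (n : ℝ) - (n : ℝ) ^ a * u) -
          stmt5P a u n * Real.cos (π * (n : ℝ) ^ a * u)| ≤
        C * Real.exp (-2 * π * (n : ℝ) ^ a) * |stmt5P a u n| := by
  obtain ⟨C, hC, h⟩ := exists_abs_qPochInfR_div_sub_le u
  obtain ⟨N, hN⟩ := Filter.eventually_atTop.1 (eventually_two_mul_rpow_sq_le ha1)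
  refine ⟨C, hC, N + 1, N.succ_pos, fun n hn => ?_⟩
  have hn1 : (1 : ℝ) ≤ n := by exact_mod_cast (by omega : 1 ≤ n)
  set t : ℝ := (n : ℝ) ^ a with ht
  have ht1 : 1 ≤ t := Real.one_le_rpow hn1 ha0.le
  have ht0 : 0 < t := by linarith
  set q : ℝ := Real.exp (-2 * π * (n : ℝ) ^ (-a)) with hq
  have hinv : (n : ℝ) ^ (-a) = 1 / t := by rw [Real.rpow_neg (by linarith), one_div]
  have hq' : q = Real.exp (-2 * π / t) := by rw [hq, hinv, mul_one_div]
  have hq0 : 0 < q := Real.exp_pos _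
  have hq1 : q < 1 := hq' ▸ exp_neg_two_pi_div_lt_one ht0
  have hmain := h t q _ n ht1 (hN n (by omega)) hq' rfl
  set M : ℝ := 2 * (-1) ^ n * Real.exp (π / t * (t * u + n) ^ 2) /
    (√t * Real.exp (π * t / 12 + π / (6 * t))) with hM
  set R : ℝ := (1 - q) ^ (n + t * u + 1 / 2) with hR
  have hR0 : 0 < R := Real.rpow_pos_of_pos (sub_pos.2 hq1) _
  have hP : stmt5P a u n = M / R := by
    rw [stmt5P, ← ht, ← hq, ← hR, hinv, hM, div_div, mul_one_div, div_div π t 6,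
      mul_comm t 6]
  have hx : q ^ (1 / 2 - (n : ℝ) - t * u) =
      Real.exp (-2 * π / t * (1 / 2 - n) + 2 * π * u) := by
    rw [hq', ← Real.exp_mul]
    congr 1
    field_simp
    ring
  have hG : 1 / qGamma q (1 / 2 - (n : ℝ) - t * u) =
      qPochInfR (Real.exp (-2 * π / t * (1 / 2 - n) + 2 * π * u)) q / qPochInfR q q / R := by
    rw [qGamma, hx, show 1 - (1 / 2 - (n : ℝ) - t * u) = n + t * u + 1 / 2 by ring, ← hR,
      one_div, mul_inv, inv_div, div_eq_mul_inv _ R]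
  rw [hG, hP, div_mul_eq_mul_div M R, ← sub_div, abs_div, abs_div M R, abs_of_pos hR0,
    mul_div_assoc']
  exact div_le_div_of_nonneg_right hmain hR0.le
end
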